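/- arXiv:2202.06436 — 2 statements merged into one kernel-verified Lean document; each statement's English description precedes it below -/
import Mathlib

section
/- Every L ∈ U(p,q) admits a unique decomposition L = diag(U_1, U_2) · S(W), where U_1 ∈ U(p), U_2 ∈ U(q), W ∈ D^I_{p,q}, and S(W) = [[ (I_p − WW*)^{-1/2}, (I_p − WW*)^{-1/2} W ], [ W*(I_p − WW*)^{-1/2}, (I_q − W*W)^{-1/2} ]]. Consequently U(p,q) is homeomorphic to U(p) × U(q) × D^I_{p,q}. -/
open Matrix ComplexOrder

namespace Matrix

section PseudoUnitaryPolar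

open scoped MatrixOrder

variable {m n : Type*} [Fintype m] [Fintype n] [DecidableEq m] [DecidableEq n]

theorem continuousOn_cfcSqrt :
    ContinuousOn (CFC.sqrt : Matrix n n ℂ → Matrix n n ℂ) {A | A.PosSemidef} := by
  open scoped Matrix.Norms.L2Operator in
  simpa only [nonneg_iff_posSemidef] using! CFC.continuousOn_sqrt (A := Matrix n n ℂ)

theorem continuous_matrix_inv {X : Type*} [TopologicalSpace X] {A : X → Matrix n n ℂ}
    (hA : Continuous A) (h : ∀ x, IsUnit (A x)) : Continuous fun x ↦ (A x)⁻¹ := by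
  refine continuous_iff_continuousAt.2 fun x ↦ ?_
  obtain ⟨u, hu⟩ := (isUnit_iff_isUnit_det (A x)).1 (h x)
  exact (continuousAt_matrix_inv (A x) (hu ▸ NormedRing.inverse_continuousAt u)).comp
    hA.continuousAt

theorem PosDef.cfcSqrt {A : Matrix n n ℂ} (hA : A.PosDef) : (CFC.sqrt A).PosDef :=
  (IsStrictlyPositive.sqrt A hA.isStrictlyPositive).posDef

theorem PosDef.cfcSqrt_mul_self {A : Matrix n n ℂ} (hA : A.PosDef) :
    CFC.sqrt A * CFC.sqrt A = A :=
  CFC.sqrt_mul_sqrt_self A hA.posSemidef.nonneg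

omit [Fintype n] [DecidableEq n] in
theorem PosDef.conjTranspose_mul_mul_eq_zero {A : Matrix m m ℂ} (hA : A.PosDef)
    {B : Matrix m n ℂ} (h : Bᴴ * A * B = 0) : B = 0 := by
  have hS : (CFC.sqrt A * B)ᴴ * (CFC.sqrt A * B) = 0 := by
    rw [conjTranspose_mul, hA.cfcSqrt.isHermitian.eq, Matrix.mul_assoc,
      ← Matrix.mul_assoc _ _ B, hA.cfcSqrt_mul_self, ← Matrix.mul_assoc, h]
  rw [conjTranspose_mul_self_eq_zero] at hS
  have := hA.cfcSqrt.isUnit.invertible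
  rw [← inv_mul_cancel_left_of_invertible (CFC.sqrt A) B, hS, Matrix.mul_zero]

omit [DecidableEq n] in
/-- A matrix intertwining the squares of two positive definite matrices intertwines the matrices
themselves. -/
theorem PosDef.mul_eq_mul_of_mul_self {P : Matrix m m ℂ} {Q : Matrix n n ℂ} (hP : P.PosDef)
    (hQ : Q.PosDef) {X : Matrix m n ℂ} (h : P * P * X = X * (Q * Q)) : P * X = X * Q := by
  set Y := P * X - X * Q with hY
  have hPQ : P * Y = -(Y * Q) := by
    simp only [hY, Matrix.mul_sub, Matrix.sub_mul, ← Matrix.mul_assoc] at *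
    rw [h]; abel
  have hp := hP.posSemidef.conjTranspose_mul_mul_same Y
  have hq := hQ.posSemidef.mul_mul_conjTranspose_same Y
  have ht : (Yᴴ * P * Y).trace = -(Y * Q * Yᴴ).trace := by
    rw [Matrix.mul_assoc, hPQ, Matrix.mul_neg, trace_neg, trace_mul_comm]
  have h0 : (Yᴴ * P * Y).trace = 0 :=
    le_antisymm (by rw [ht]; simpa using hq.trace_nonneg) hp.trace_nonneg
  exact sub_eq_zero.1 (hP.conjTranspose_mul_mul_eq_zero (hp.trace_eq_zero_iff.1 h0))

theorem PosDef.eq_inv_cfcSqrt {A P : Matrix n n ℂ} (hA : A.PosDef) (hP : P.PosDef)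
    (h : P * P = A⁻¹) : P = (CFC.sqrt A)⁻¹ := by
  rw [hA.posSemidef.inv_sqrt]
  exact (CFC.sqrt_unique h hP.posSemidef.nonneg).symm

theorem PosDef.inv_cfcSqrt_mul_self {A : Matrix n n ℂ} (hA : A.PosDef) :
    (CFC.sqrt A)⁻¹ * (CFC.sqrt A)⁻¹ = A⁻¹ := by
  rw [← Matrix.mul_inv_rev, hA.cfcSqrt_mul_self]

theorem posDef_one_sub_mul_conjTranspose {W : Matrix m n ℂ} (h : (1 - Wᴴ * W).PosDef) :
    (1 - W * Wᴴ).PosDef := by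
  have h1 : (1 - W * Wᴴ).PosSemidef := by
    have := invertibleOne (α := Matrix m m ℂ)
    have := invertibleOne (α := Matrix n n ℂ)
    have := (PosDef.fromBlocks₂₂ (1 : Matrix m m ℂ) W (PosDef.one (n := n))).1
      ((PosDef.fromBlocks₁₁ W (1 : Matrix n n ℂ) (PosDef.one (n := m))).2
        (by simpa using h.posSemidef))
    simpa using this
  rw [h1.posDef_iff_det_ne_zero, det_one_sub_mul_comm]
  exact h.posSemidef.posDef_iff_det_ne_zero.1 h

/-- The positive square root of `1 - W Wᴴ`. -/
noncomputable def defectSqrt (W : Matrix m n ℂ) : Matrix m m ℂ := CFC.sqrt (1 - W * Wᴴ)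

theorem posDef_defectSqrt {W : Matrix m n ℂ} (h : (1 - Wᴴ * W).PosDef) :
    (defectSqrt W).PosDef :=
  (posDef_one_sub_mul_conjTranspose h).cfcSqrt

theorem defectSqrt_mul_self {W : Matrix m n ℂ} (h : (1 - Wᴴ * W).PosDef) :
    defectSqrt W * defectSqrt W = 1 - W * Wᴴ :=
  (posDef_one_sub_mul_conjTranspose h).cfcSqrt_mul_self

omit [DecidableEq m] in
theorem posDef_defectSqrt_conjTranspose {W : Matrix m n ℂ} (h : (1 - Wᴴ * W).PosDef) :
    (defectSqrt Wᴴ).PosDef := by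
  simpa [defectSqrt] using h.cfcSqrt

omit [DecidableEq m] in
theorem defectSqrt_conjTranspose_mul_self {W : Matrix m n ℂ} (h : (1 - Wᴴ * W).PosDef) :
    defectSqrt Wᴴ * defectSqrt Wᴴ = 1 - Wᴴ * W := by
  simpa [defectSqrt] using h.cfcSqrt_mul_self

theorem defectSqrt_mul_comm {W : Matrix m n ℂ} (h : (1 - Wᴴ * W).PosDef) :
    defectSqrt W * W = W * defectSqrt Wᴴ := by
  refine (posDef_defectSqrt h).mul_eq_mul_of_mul_self (posDef_defectSqrt_conjTranspose h) ?_
  rw [defectSqrt_mul_self h, defectSqrt_conjTranspose_mul_self h, Matrix.sub_mul, Matrix.mul_sub,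
    Matrix.one_mul, Matrix.mul_one, Matrix.mul_assoc]

theorem defectSqrt_conjTranspose_mul_comm {W : Matrix m n ℂ} (h : (1 - Wᴴ * W).PosDef) :
    defectSqrt Wᴴ * Wᴴ = Wᴴ * defectSqrt W := by
  have := congrArg conjTranspose (defectSqrt_mul_comm h)
  simpa only [conjTranspose_mul, (posDef_defectSqrt h).isHermitian.eq,
    (posDef_defectSqrt_conjTranspose h).isHermitian.eq] using this.symm

/-- The matrix `diag(U₁, U₂) S(W)`. -/
noncomputable def polarMatrix (T : Matrix m m ℂ × Matrix n n ℂ × Matrix m n ℂ) :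
    Matrix (m ⊕ n) (m ⊕ n) ℂ :=
  fromBlocks T.1 0 0 T.2.1 * fromBlocks (defectSqrt T.2.2)⁻¹ ((defectSqrt T.2.2)⁻¹ * T.2.2)
    (T.2.2ᴴ * (defectSqrt T.2.2)⁻¹) (defectSqrt T.2.2ᴴ)⁻¹

/-- The candidate for the parameters `(U₁, U₂, W)` of a matrix in `U(p, q)`. -/
noncomputable def polarParams (M : Matrix (m ⊕ n) (m ⊕ n) ℂ) :
    Matrix m m ℂ × Matrix n n ℂ × Matrix m n ℂ :=
  (M.toBlocks₁₁ * defectSqrt (M.toBlocks₁₁⁻¹ * M.toBlocks₁₂),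
    M.toBlocks₂₂ * defectSqrt (M.toBlocks₁₁⁻¹ * M.toBlocks₁₂)ᴴ,
    M.toBlocks₁₁⁻¹ * M.toBlocks₁₂)

theorem polarMatrix_eq_iff_forall {T : Matrix m m ℂ × Matrix n n ℂ × Matrix m n ℂ}
    (hW : (1 - T.2.2ᴴ * T.2.2).PosDef) (M : Matrix (m ⊕ n) (m ⊕ n) ℂ) :
    M = polarMatrix T ↔ ∀ (P : Matrix m m ℂ) (Q : Matrix n n ℂ),
        P.PosDef → P * P = (1 - T.2.2 * T.2.2ᴴ)⁻¹ →
        Q.PosDef → Q * Q = (1 - T.2.2ᴴ * T.2.2)⁻¹ →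
        M = fromBlocks T.1 0 0 T.2.1 * fromBlocks P (P * T.2.2) (T.2.2ᴴ * P) Q := by
  have hW' := posDef_one_sub_mul_conjTranspose hW
  have hd : defectSqrt T.2.2ᴴ = CFC.sqrt (1 - T.2.2ᴴ * T.2.2) := by simp [defectSqrt]
  constructor
  · rintro rfl P Q hP hP2 hQ hQ2
    rw [polarMatrix, hd, hW'.eq_inv_cfcSqrt hP hP2, hW.eq_inv_cfcSqrt hQ hQ2]
    rfl
  · intro h
    refine h _ _ (posDef_defectSqrt hW).inv hW'.inv_cfcSqrt_mul_self
      (posDef_defectSqrt_conjTranspose hW).inv ?_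
    rw [hd, hW.inv_cfcSqrt_mul_self]

theorem polarParams_polarMatrix {T : Matrix m m ℂ × Matrix n n ℂ × Matrix m n ℂ}
    (h1 : T.1 ∈ unitaryGroup m ℂ) (hW : (1 - T.2.2ᴴ * T.2.2).PosDef) :
    polarParams (polarMatrix T) = T := by
  obtain ⟨U, V, W⟩ := T
  have := (posDef_defectSqrt hW).isUnit.invertible
  have := (posDef_defectSqrt_conjTranspose hW).isUnit.invertible
  have : Invertible U := invertibleOfLeftInverse _ _ (mem_unitaryGroup_iff'.1 h1)
  have : Invertible (U * (defectSqrt W)⁻¹) := invertibleMul _ _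
  have hW' : (U * (defectSqrt W)⁻¹)⁻¹ * (U * ((defectSqrt W)⁻¹ * W)) = W := by
    rw [← Matrix.mul_assoc U, inv_mul_cancel_left_of_invertible]
  simp only at *
  simp [polarParams, polarMatrix, fromBlocks_multiply, hW']

theorem polarMatrix_mem {T : Matrix m m ℂ × Matrix n n ℂ × Matrix m n ℂ}
    (h1 : T.1 ∈ unitaryGroup m ℂ) (h2 : T.2.1 ∈ unitaryGroup n ℂ)
    (hW : (1 - T.2.2ᴴ * T.2.2).PosDef) :
    (polarMatrix T)ᴴ * fromBlocks 1 0 0 (-1) * polarMatrix T = fromBlocks 1 0 0 (-1) := by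
  obtain ⟨U, V, W⟩ := T
  simp only at *
  have hU : Uᴴ * U = 1 := mem_unitaryGroup_iff'.1 h1
  have hV : Vᴴ * V = 1 := mem_unitaryGroup_iff'.1 h2
  have hD : (fromBlocks U 0 0 V)ᴴ * fromBlocks 1 0 0 (-1) * fromBlocks U 0 0 V =
      fromBlocks 1 0 0 (-1) := by
    simp [fromBlocks_conjTranspose, fromBlocks_multiply, hU, hV]
  set S := fromBlocks (defectSqrt W)⁻¹ ((defectSqrt W)⁻¹ * W)
    (Wᴴ * (defectSqrt W)⁻¹) (defectSqrt Wᴴ)⁻¹ with hS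
  have hSS : Sᴴ * fromBlocks 1 0 0 (-1) * S = fromBlocks 1 0 0 (-1) := by
    have hR := posDef_defectSqrt hW
    have hR' := posDef_defectSqrt_conjTranspose hW
    have := hR.isUnit.invertible
    have := hR'.isUnit.invertible
    have hc : (defectSqrt W)⁻¹ * W = W * (defectSqrt Wᴴ)⁻¹ := by
      rw [← mul_inv_cancel_right_of_invertible (defectSqrt Wᴴ) ((defectSqrt W)⁻¹ * W),
        Matrix.mul_assoc _ W, ← defectSqrt_mul_comm hW, inv_mul_cancel_left_of_invertible]
    have e1 : (defectSqrt W)⁻¹ * (1 - W * Wᴴ) * (defectSqrt W)⁻¹ = 1 := by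
      rw [← defectSqrt_mul_self hW]; simp
    have e2 : (defectSqrt Wᴴ)⁻¹ * (1 - Wᴴ * W) * (defectSqrt Wᴴ)⁻¹ = 1 := by
      rw [← defectSqrt_conjTranspose_mul_self hW]; simp
    simp only [Matrix.mul_sub, Matrix.sub_mul, Matrix.mul_one, ← Matrix.mul_assoc] at e1 e2
    have hc' : Wᴴ * (defectSqrt W)⁻¹ = (defectSqrt Wᴴ)⁻¹ * Wᴴ := by
      have := congrArg conjTranspose hc
      simpa only [conjTranspose_mul, hR.inv.isHermitian.eq, hR'.inv.isHermitian.eq] using this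
    rw [hS, fromBlocks_conjTranspose, fromBlocks_multiply, fromBlocks_multiply, fromBlocks_inj]
    simp only [conjTranspose_mul, hR.inv.isHermitian.eq, hR'.inv.isHermitian.eq,
      conjTranspose_conjTranspose, Matrix.mul_one, Matrix.mul_zero, add_zero,
      zero_add, Matrix.mul_neg, Matrix.neg_mul, ← Matrix.mul_assoc]
    simp only [← sub_eq_add_neg]
    refine ⟨e1, ?_, ?_, ?_⟩
    · rw [Matrix.mul_assoc _ _ W, Matrix.mul_assoc _ W, ← hc, sub_self]
    · rw [hc', Matrix.mul_assoc _ Wᴴ, hc', ← Matrix.mul_assoc, sub_self]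
    · rw [hc', Matrix.mul_assoc _ _ W, hc, ← neg_eq_iff_eq_neg, neg_sub, ← Matrix.mul_assoc, e2]
  calc _ = Sᴴ * ((fromBlocks U 0 0 V)ᴴ * fromBlocks 1 0 0 (-1) * fromBlocks U 0 0 V) * S := by
        simp only [polarMatrix, ← hS, conjTranspose_mul, Matrix.mul_assoc]
    _ = _ := by rw [hD, hSS]

theorem mul_signature_mul_conjTranspose {M : Matrix (m ⊕ n) (m ⊕ n) ℂ}
    (hM : Mᴴ * fromBlocks 1 0 0 (-1) * M = fromBlocks 1 0 0 (-1)) :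
    M * fromBlocks 1 0 0 (-1) * Mᴴ = fromBlocks 1 0 0 (-1) := by
  have hJ : (fromBlocks 1 0 0 (-1) : Matrix (m ⊕ n) (m ⊕ n) ℂ) * fromBlocks 1 0 0 (-1) = 1 := by
    simp [fromBlocks_multiply]
  have h : M * (fromBlocks 1 0 0 (-1) * Mᴴ * fromBlocks 1 0 0 (-1)) = 1 := by
    rw [mul_eq_one_comm, Matrix.mul_assoc, Matrix.mul_assoc, ← Matrix.mul_assoc Mᴴ, hM, hJ]
  calc _ = M * (fromBlocks 1 0 0 (-1) * Mᴴ * fromBlocks 1 0 0 (-1)) * fromBlocks 1 0 0 (-1) := by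
        simp only [Matrix.mul_assoc, hJ, Matrix.mul_one]
    _ = _ := by rw [h, Matrix.one_mul]

omit [DecidableEq m] in
theorem isUnit_of_conjTranspose_mul_self_eq {A : Matrix n n ℂ} {C : Matrix m n ℂ}
    (h : Aᴴ * A = 1 + Cᴴ * C) : IsUnit A := by
  have hp : (Aᴴ * A).PosDef := h ▸ PosDef.one.add_posSemidef (posSemidef_conjTranspose_mul_self C)
  exact isUnit_of_mul_isUnit_right hp.isUnit

theorem isUnit_toBlocks₁₁ {M : Matrix (m ⊕ n) (m ⊕ n) ℂ}
    (hM : Mᴴ * fromBlocks 1 0 0 (-1) * M = fromBlocks 1 0 0 (-1)) : IsUnit M.toBlocks₁₁ := by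
  rw [← fromBlocks_toBlocks M] at hM
  simp only [fromBlocks_conjTranspose, fromBlocks_multiply, fromBlocks_inj] at hM
  simp only [Matrix.mul_one, Matrix.mul_zero, add_zero, zero_add, Matrix.mul_neg, Matrix.neg_mul]
    at hM
  simp only [← sub_eq_add_neg] at hM
  exact isUnit_of_conjTranspose_mul_self_eq (sub_eq_iff_eq_add.1 hM.1)

theorem polarParams_mem {M : Matrix (m ⊕ n) (m ⊕ n) ℂ}
    (hM : Mᴴ * fromBlocks 1 0 0 (-1) * M = fromBlocks 1 0 0 (-1)) :
    (polarParams M).1 ∈ unitaryGroup m ℂ ∧ (polarParams M).2.1 ∈ unitaryGroup n ℂ ∧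
      (1 - (polarParams M).2.2ᴴ * (polarParams M).2.2).PosDef ∧
      polarMatrix (polarParams M) = M := by
  have hA := isUnit_toBlocks₁₁ hM
  have hM' := mul_signature_mul_conjTranspose hM
  obtain ⟨A, B, C, D, rfl⟩ : ∃ A B C D, M = fromBlocks A B C D :=
    ⟨_, _, _, _, (fromBlocks_toBlocks M).symm⟩
  simp only [fromBlocks_conjTranspose, fromBlocks_multiply, fromBlocks_inj] at hM hM'
  simp only [Matrix.mul_one, Matrix.mul_zero, add_zero, zero_add, Matrix.mul_neg, Matrix.neg_mul,
    toBlocks_fromBlocks₁₁] at hM hM' hA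
  simp only [← sub_eq_add_neg] at hM hM'
  obtain ⟨-, -, -, hDB⟩ := hM
  obtain ⟨hAA, -, hCA, hDD⟩ := hM'
  have hD : IsUnit D := isUnit_of_conjTranspose_mul_self_eq (C := B) <| by
    rw [← sub_eq_iff_eq_add, ← neg_sub, hDB, neg_neg]
  have := hA.invertible
  obtain ⟨W, hW⟩ : ∃ W, W = A⁻¹ * B := ⟨_, rfl⟩
  have hB : A * W = B := by simp [hW]
  have hC : D * Wᴴ = C := by
    have : Invertible Aᴴ := ((isUnit_conjTranspose A).2 hA).invertible
    rw [← mul_inv_cancel_right_of_invertible Aᴴ (D * Wᴴ), Matrix.mul_assoc D, ← conjTranspose_mul,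
      hB, ← sub_eq_zero.1 hCA, mul_inv_cancel_right_of_invertible]
  have hDW : D * (1 - Wᴴ * W) * Dᴴ = 1 := by
    rw [← neg_inj, ← hDD, ← hC]
    simp [Matrix.mul_sub, Matrix.sub_mul, Matrix.mul_assoc]
  have hAW : A * (1 - W * Wᴴ) * Aᴴ = 1 := by
    refine Eq.trans ?_ hAA
    rw [← hB]
    simp [Matrix.mul_sub, Matrix.sub_mul, Matrix.mul_assoc]
  have hpos : (1 - Wᴴ * W).PosDef := by
    rw [← hD.posDef_star_right_conjugate_iff, star_eq_conjTranspose, hDW]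
    exact PosDef.one
  have hR := posDef_defectSqrt hpos
  have hR' := posDef_defectSqrt_conjTranspose hpos
  have := hR.isUnit.invertible
  have := hR'.isUnit.invertible
  have hT : polarParams (fromBlocks A B C D) = (A * defectSqrt W, D * defectSqrt Wᴴ, W) := by
    simp [polarParams, hW]
  rw [hT]
  refine ⟨?_, ?_, hpos, ?_⟩
  · rw [mem_unitaryGroup_iff, star_eq_conjTranspose, conjTranspose_mul, hR.isHermitian.eq,
      Matrix.mul_assoc, ← Matrix.mul_assoc (defectSqrt W), defectSqrt_mul_self hpos,
      ← Matrix.mul_assoc, hAW]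
  · rw [mem_unitaryGroup_iff, star_eq_conjTranspose, conjTranspose_mul, hR'.isHermitian.eq,
      Matrix.mul_assoc, ← Matrix.mul_assoc (defectSqrt Wᴴ),
      defectSqrt_conjTranspose_mul_self hpos, ← Matrix.mul_assoc, hDW]
  · simp only [polarMatrix, fromBlocks_multiply, Matrix.zero_mul, add_zero, zero_add,
      fromBlocks_inj]
    refine ⟨by simp, ?_, ?_, by simp⟩
    · rw [← Matrix.mul_assoc, mul_inv_cancel_right_of_invertible, hB]
    · rw [← Matrix.mul_assoc, Matrix.mul_assoc D, defectSqrt_conjTranspose_mul_comm hpos,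
        ← Matrix.mul_assoc, mul_inv_cancel_right_of_invertible, hC]

section Continuity

variable {X : Type*} [TopologicalSpace X]

theorem continuous_defectSqrt {W : X → Matrix m n ℂ} (hW : Continuous W)
    (h : ∀ x, (1 - (W x)ᴴ * W x).PosDef) : Continuous fun x ↦ defectSqrt (W x) :=
  continuousOn_cfcSqrt.comp_continuous
    (continuous_const.sub (hW.matrix_mul hW.matrix_conjTranspose))
    fun x ↦ (posDef_one_sub_mul_conjTranspose (h x)).posSemidef

theorem continuous_defectSqrt_conjTranspose {W : X → Matrix m n ℂ} (hW : Continuous W)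
    (h : ∀ x, (1 - (W x)ᴴ * W x).PosDef) : Continuous fun x ↦ defectSqrt (W x)ᴴ :=
  continuous_defectSqrt hW.matrix_conjTranspose fun x ↦ by
    simpa using posDef_one_sub_mul_conjTranspose (h x)

theorem continuous_polarMatrix {U : X → Matrix m m ℂ} {V : X → Matrix n n ℂ}
    {W : X → Matrix m n ℂ} (hU : Continuous U) (hV : Continuous V) (hW : Continuous W)
    (h : ∀ x, (1 - (W x)ᴴ * W x).PosDef) : Continuous fun x ↦ polarMatrix (U x, V x, W x) := by
  have h1 := continuous_matrix_inv (continuous_defectSqrt hW h)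
    fun x ↦ (posDef_defectSqrt (h x)).isUnit
  have h2 := continuous_matrix_inv (continuous_defectSqrt_conjTranspose hW h)
    fun x ↦ (posDef_defectSqrt_conjTranspose (h x)).isUnit
  exact (hU.matrix_fromBlocks continuous_const continuous_const hV).matrix_mul
    (h1.matrix_fromBlocks (h1.matrix_mul hW) (hW.matrix_conjTranspose.matrix_mul h1) h2)

theorem continuous_polarParams {M : X → Matrix (m ⊕ n) (m ⊕ n) ℂ} (hM : Continuous M)
    (h : ∀ x, (M x)ᴴ * fromBlocks 1 0 0 (-1) * M x = fromBlocks 1 0 0 (-1)) :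
    Continuous fun x ↦ polarParams (M x) := by
  have hA : Continuous fun x ↦ (M x).toBlocks₁₁ := hM.matrix_submatrix _ _
  have hB : Continuous fun x ↦ (M x).toBlocks₁₂ := hM.matrix_submatrix _ _
  have hD : Continuous fun x ↦ (M x).toBlocks₂₂ := hM.matrix_submatrix _ _
  have hW : Continuous fun x ↦ (M x).toBlocks₁₁⁻¹ * (M x).toBlocks₁₂ :=
    (continuous_matrix_inv hA fun x ↦ isUnit_toBlocks₁₁ (h x)).matrix_mul hB
  have hpos (x : X) := (polarParams_mem (h x)).2.2.1
  exact (hA.matrix_mul (continuous_defectSqrt hW hpos)).prodMk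
    ((hD.matrix_mul (continuous_defectSqrt_conjTranspose hW hpos)).prodMk hW)

end Continuity

/-- The decomposition `L = diag(U₁, U₂) S(W)` as a homeomorphism from `U(p, q)`. -/
noncomputable def polarHomeomorph (m n : Type*) [Fintype m] [Fintype n] [DecidableEq m]
    [DecidableEq n] :
    {M : Matrix (m ⊕ n) (m ⊕ n) ℂ //
        Mᴴ * fromBlocks 1 0 0 (-1) * M = fromBlocks 1 0 0 (-1)} ≃ₜ
      unitaryGroup m ℂ × unitaryGroup n ℂ × {W : Matrix m n ℂ // (1 - Wᴴ * W).PosDef} where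
  toFun M := (⟨(polarParams M.1).1, (polarParams_mem M.2).1⟩,
    ⟨(polarParams M.1).2.1, (polarParams_mem M.2).2.1⟩,
    ⟨(polarParams M.1).2.2, (polarParams_mem M.2).2.2.1⟩)
  invFun T := ⟨polarMatrix (T.1.1, T.2.1.1, T.2.2.1),
    polarMatrix_mem T.1.2 T.2.1.2 T.2.2.2⟩
  left_inv M := Subtype.ext (polarParams_mem M.2).2.2.2
  right_inv T := by
    have h := polarParams_polarMatrix (T := (T.1.1, T.2.1.1, T.2.2.1)) T.1.2 T.2.2.2
    exact Prod.ext (Subtype.ext (congrArg Prod.fst h))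
      (Prod.ext (Subtype.ext (congrArg (fun T ↦ T.2.1) h))
        (Subtype.ext (congrArg (fun T ↦ T.2.2) h)))
  continuous_toFun := by
    have h := continuous_polarParams (M := fun M : {M : Matrix (m ⊕ n) (m ⊕ n) ℂ //
      Mᴴ * fromBlocks 1 0 0 (-1) * M = fromBlocks 1 0 0 (-1)} ↦ M.1)
      continuous_subtype_val fun M ↦ M.2
    exact (h.fst.subtype_mk _).prodMk
      ((h.snd.fst.subtype_mk _).prodMk (h.snd.snd.subtype_mk _))
  continuous_invFun :=
    (continuous_polarMatrix (continuous_subtype_val.comp continuous_fst)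
      (continuous_subtype_val.comp continuous_snd.fst)
      (continuous_subtype_val.comp continuous_snd.snd) fun T ↦ T.2.2.2).subtype_mk _

end PseudoUnitaryPolar

end Matrix

/-- Every `L ∈ U(p,q)` admits a unique decomposition `L = diag(U₁,U₂)·S(W)` with
`U₁ ∈ U(p)`, `U₂ ∈ U(q)`, `W ∈ D^I_{p,q}`, where `S(W)` is built from the positive
square roots `P = (I − WWᴴ)^{-1/2}`, `Q = (I − WᴴW)^{-1/2}`; consequently `U(p,q)` is
homeomorphic to `U(p) × U(q) × D^I_{p,q}`. -/
theorem stmt6 (p q : ℕ) (L : Matrix (Fin p ⊕ Fin q) (Fin p ⊕ Fin q) ℂ)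
    (hL : Lᴴ * Matrix.fromBlocks 1 0 0 (-1) * L = Matrix.fromBlocks 1 0 0 (-1)) :
    (∃! T : Matrix (Fin p) (Fin p) ℂ × Matrix (Fin q) (Fin q) ℂ × Matrix (Fin p) (Fin q) ℂ,
      T.1 ∈ Matrix.unitaryGroup (Fin p) ℂ ∧ T.2.1 ∈ Matrix.unitaryGroup (Fin q) ℂ ∧
      (1 - T.2.2ᴴ * T.2.2).PosDef ∧
      ∀ (P : Matrix (Fin p) (Fin p) ℂ) (Q : Matrix (Fin q) (Fin q) ℂ),
        P.PosDef → P * P = (1 - T.2.2 * T.2.2ᴴ)⁻¹ →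
        Q.PosDef → Q * Q = (1 - T.2.2ᴴ * T.2.2)⁻¹ →
        L = Matrix.fromBlocks T.1 0 0 T.2.1 *
            Matrix.fromBlocks P (P * T.2.2) (T.2.2ᴴ * P) Q) ∧
    Nonempty
      ({M : Matrix (Fin p ⊕ Fin q) (Fin p ⊕ Fin q) ℂ //
          Mᴴ * Matrix.fromBlocks 1 0 0 (-1) * M = Matrix.fromBlocks 1 0 0 (-1)} ≃ₜ
        Matrix.unitaryGroup (Fin p) ℂ × Matrix.unitaryGroup (Fin q) ℂ ×
          {W : Matrix (Fin p) (Fin q) ℂ // (1 - Wᴴ * W).PosDef}) := by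
  refine ⟨⟨polarParams L, ?_, ?_⟩, ⟨polarHomeomorph (Fin p) (Fin q)⟩⟩
  · obtain ⟨h1, h2, h3, h4⟩ := polarParams_mem hL
    exact ⟨h1, h2, h3, (polarMatrix_eq_iff_forall h3 L).1 h4.symm⟩
  · rintro T ⟨h1, h2, h3, h4⟩
    rw [(polarMatrix_eq_iff_forall h3 L).2 h4, polarParams_polarMatrix h1 h3]
end

section
/- Define ρ: U(p) → R by ρ(A) = Σ_{j: θ_j ≠ 0} (1 − θ_j/π), where e^{iθ_1}, …, e^{iθ_p} are the eigenvalues of A with θ_j ∈ [0, 2π). Then for all A, B, C ∈ U(p) with ABC = I_p, one has |ρ(A) + ρ(B) + ρ(C)| ≤ p. -/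
open scoped BigOperators

namespace RhoInvariant

open Complex Matrix

section Diag
open scoped Matrix.Norms.L2Operator
variable {n : Type*} [Fintype n] [DecidableEq n]

lemma exp_conj_diagonal (P : unitaryGroup n ℂ) (v : n → ℂ) :
    NormedSpace.exp ((P : Matrix n n ℂ) * diagonal v * star (P : Matrix n n ℂ)) =
      P * diagonal (fun j => exp (v j)) * star (P : Matrix n n ℂ) := by
  have h := Matrix.exp_units_conj (Unitary.toUnits P) (diagonal v)
  have h2 : ((Unitary.toUnits P)⁻¹ : (Matrix n n ℂ)ˣ) = star (P : Matrix n n ℂ) := rfl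
  rw [h2] at h
  refine h.trans ?_
  rw [Matrix.exp_diagonal]
  congr 3
  ext j
  simp [Pi.coe_exp, Complex.exp_eq_exp_ℂ]

lemma exists_exp_selfAdjoint {U : Matrix n n ℂ} (hU : U ∈ unitaryGroup n ℂ) :
    ∃ H : Matrix n n ℂ, H.IsHermitian ∧ NormedSpace.exp (I • H) = U := by
  have hn : IsStarNormal U := ⟨by
    rw [commute_iff_eq, Unitary.star_mul_self_of_mem hU, Unitary.mul_star_self_of_mem hU]⟩
  have hfin : (spectrum ℂ U).Finite := Matrix.finite_spectrum U
  have hc (f : ℂ → ℂ) : ContinuousOn f (spectrum ℂ U) := hfin.continuousOn f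
  refine ⟨cfc (fun z : ℂ => (arg z : ℂ)) U, ?_, ?_⟩
  · change star _ = _
    rw [← cfc_star]
    simp
  · rw [← cfc_const_mul I _ U (hc _), ← CFC.exp_eq_normedSpace_exp (𝕜 := ℂ)]
    rw [← cfc_comp' _ _ _ ((hfin.image _).continuousOn _) (hc _)]
    conv_rhs => rw [← cfc_id ℂ U]
    refine cfc_congr fun z hz => ?_
    have h1 : ‖z‖ = 1 := by
      simpa using spectrum.subset_circle_of_unitary hU hz
    have := Complex.norm_mul_exp_arg_mul_I z
    rw [h1] at this
    simpa [← Complex.exp_eq_exp_ℂ, mul_comm I] using this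
end Diag

noncomputable section

/-- The argument of a complex number, normalised to lie in `[0, 2π)`. -/
def posArg (z : ℂ) : ℝ := toIcoMod Real.two_pi_pos 0 (arg z)

lemma posArg_exp {t : ℝ} (h0 : 0 ≤ t) (h1 : t < 2 * Real.pi) : posArg (exp (I * t)) = t := by
  rw [posArg, mul_comm I, Complex.arg_exp_mul_I, toIcoMod_toIocMod, toIcoMod_eq_self]
  simpa using ⟨h0, h1⟩

lemma posArg_nonneg (z : ℂ) : 0 ≤ posArg z := (toIcoMod_mem_Ico' Real.two_pi_pos _).1

lemma posArg_lt (z : ℂ) : posArg z < 2 * Real.pi := (toIcoMod_mem_Ico' Real.two_pi_pos _).2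

lemma exp_I_mul_posArg_ofReal (t : ℝ) : exp (I * posArg (exp (I * t))) = exp (I * t) := by
  rw [posArg, mul_comm I (t : ℂ), Complex.arg_exp_mul_I, toIcoMod_toIocMod, toIcoMod]
  push_cast
  rw [Complex.exp_eq_exp_iff_exists_int]
  refine ⟨-toIcoDiv Real.two_pi_pos 0 t, ?_⟩
  simp
  ring

variable {n : Type*} [Fintype n] [DecidableEq n]

/-- The sum over the eigenvalues of a matrix of their arguments in `[0, 2π)`. -/
def angleSum (M : Matrix n n ℂ) : ℝ := (M.charpoly.roots.map posArg).sum

lemma angleSum_eq {M : Matrix n n ℂ} {θ : n → ℝ} (h : ∀ j, 0 ≤ θ j ∧ θ j < 2 * Real.pi)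
    (hM : M.charpoly = ∏ j, (Polynomial.X - Polynomial.C (exp (I * (θ j : ℂ))))) :
    angleSum M = ∑ j, θ j := by
  have : M.charpoly.roots = Finset.univ.val.map fun j => exp (I * (θ j : ℂ)) := by
    rw [hM]
    simpa [Multiset.map_map, Function.comp_def] using Polynomial.roots_multiset_prod_X_sub_C
      (Finset.univ.val.map fun j => exp (I * (θ j : ℂ)))
  rw [angleSum, this, Multiset.map_map]
  exact Finset.sum_congr rfl fun j _ => posArg_exp (h j).1 (h j).2

lemma charpoly_unitary_conj {P : Matrix n n ℂ} (hP : P ∈ unitaryGroup n ℂ) (M : Matrix n n ℂ) :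
    (P * M * star P).charpoly = M.charpoly := by
  rw [charpoly_mul_comm, ← mul_assoc, Unitary.star_mul_self_of_mem hP, one_mul]

lemma angleSum_unitary_conj {P : Matrix n n ℂ} (hP : P ∈ unitaryGroup n ℂ) (M : Matrix n n ℂ) :
    angleSum (P * M * star P) = angleSum M := by
  rw [angleSum, angleSum, charpoly_unitary_conj hP]

/-- `M` is diagonalised by the unitary matrix `P`, with eigenvalues `exp (i θ j)`,
`θ j ∈ [0, 2π)`. -/
structure IsAngleDiag (M P : Matrix n n ℂ) (θ : n → ℝ) : Prop where
  mem : P ∈ unitaryGroup n ℂ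
  angle_mem : ∀ j, 0 ≤ θ j ∧ θ j < 2 * Real.pi
  eq : M = P * diagonal (fun j => exp (I * θ j)) * star P

lemma exists_isAngleDiag {U : Matrix n n ℂ} (hU : U ∈ unitaryGroup n ℂ) :
    ∃ P θ, IsAngleDiag U P θ := by
  obtain ⟨H, hH, rfl⟩ := exists_exp_selfAdjoint hU
  refine ⟨hH.eigenvectorUnitary, fun j => posArg (exp (I * hH.eigenvalues j)),
    hH.eigenvectorUnitary.2, fun j => ⟨posArg_nonneg _, posArg_lt _⟩, ?_⟩
  simp_rw [exp_I_mul_posArg_ofReal]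
  rw [← exp_conj_diagonal]
  congr 1
  conv_lhs => rw [hH.spectral_theorem, Unitary.conjStarAlgAut_apply, ← smul_mul_assoc,
    ← mul_smul_comm, ← diagonal_smul]
  rfl

namespace IsAngleDiag

variable {M P : Matrix n n ℂ} {θ : n → ℝ}

lemma charpoly_eq (h : IsAngleDiag M P θ) :
    M.charpoly = ∏ j, (Polynomial.X - Polynomial.C (exp (I * (θ j : ℂ)))) := by
  rw [h.eq, charpoly_unitary_conj h.mem, charpoly_diagonal]

lemma angleSum_eq (h : IsAngleDiag M P θ) : angleSum M = ∑ j, θ j :=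
  RhoInvariant.angleSum_eq h.angle_mem h.charpoly_eq

lemma exp_angleSum (h : IsAngleDiag M P θ) : exp (I * angleSum M) = M.det := by
  rw [h.angleSum_eq, h.eq, det_mul_right_comm, Unitary.mul_star_self_of_mem h.mem, one_mul,
    det_diagonal, ← Complex.exp_sum, ofReal_sum, Finset.mul_sum]

/-- The Rayleigh quotient of a unitary matrix in terms of an eigenbasis. -/
lemma star_dotProduct_mulVec (h : IsAngleDiag M P θ) (x : n → ℂ) :
    star x ⬝ᵥ (M *ᵥ x) = ∑ j, exp (I * θ j) * (normSq ((star P *ᵥ x) j) : ℂ) := by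
  have h1 : star x ⬝ᵥ (M *ᵥ x) =
      star (star P *ᵥ x) ⬝ᵥ (diagonal (fun j => exp (I * θ j)) *ᵥ (star P *ᵥ x)) := by
    rw [h.eq, star_mulVec, ← dotProduct_mulVec, star_eq_conjTranspose, conjTranspose_conjTranspose]
    simp only [mulVec_mulVec, mul_assoc]
  rw [h1, dotProduct]
  refine Finset.sum_congr rfl fun j _ => ?_
  rw [mulVec_diagonal, Complex.normSq_eq_conj_mul_self]
  simp only [Pi.star_apply, RCLike.star_def]
  ring

lemma star_dotProduct_self (h : IsAngleDiag M P θ) (x : n → ℂ) :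
    star x ⬝ᵥ x = ∑ j, (normSq ((star P *ᵥ x) j) : ℂ) := by
  have h1 : star x ⬝ᵥ x = star (star P *ᵥ x) ⬝ᵥ (star P *ᵥ x) := by
    rw [star_mulVec, ← dotProduct_mulVec, star_eq_conjTranspose, conjTranspose_conjTranspose,
      mulVec_mulVec, ← star_eq_conjTranspose, Unitary.mul_star_self_of_mem h.mem, one_mulVec]
  rw [h1, dotProduct]
  exact Finset.sum_congr rfl fun j _ => by rw [Complex.normSq_eq_conj_mul_self]; rfl

/-- The separating functional `z ↦ Re (exp (-i s / 2) z) - cos (s / 2)`, applied to the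
numerical range. -/
lemma re_rayleigh (h : IsAngleDiag M P θ) (s : ℝ) (x : n → ℂ) :
    (exp (I * (-(s / 2) : ℝ)) * (star x ⬝ᵥ (M *ᵥ x)) - (Real.cos (s / 2) : ℂ) * (star x ⬝ᵥ x)).re =
      ∑ j, (Real.cos (θ j - s / 2) - Real.cos (s / 2)) * normSq ((star P *ᵥ x) j) := by
  rw [h.star_dotProduct_mulVec, h.star_dotProduct_self, Finset.mul_sum, Finset.mul_sum,
    ← Finset.sum_sub_distrib, re_sum]
  refine Finset.sum_congr rfl fun j _ => ?_
  rw [← mul_assoc, ← Complex.exp_add, ← mul_add, ← sub_mul, re_mul_ofReal, ← ofReal_add, mul_comm I,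
    sub_re, Complex.exp_ofReal_mul_I_re, ofReal_re, neg_add_eq_sub]

/-- Interlacing: unitary matrices that agree on a hyperplane have eigenangle counting functions
differing by at most one. -/
lemma card_le_card_add_one {U V Q : Matrix n n ℂ} {γ β : n → ℝ} (hU : IsAngleDiag U P γ)
    (hV : IsAngleDiag V Q β) (ℓ : (n → ℂ) →ₗ[ℂ] ℂ) (hℓ : ∀ x, ℓ x = 0 → U *ᵥ x = V *ᵥ x)
    {s : ℝ} (hs0 : 0 ≤ s) (hs : s ≤ 2 * Real.pi) :
    Fintype.card {j // s < γ j} ≤ Fintype.card {j // s < β j} + 1 := by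
  by_contra! hlt
  let F : (n → ℂ) →ₗ[ℂ] ({j // s < β j} → ℂ) × ({j // ¬ s < γ j} → ℂ) × ℂ :=
    ((LinearMap.funLeft ℂ ℂ Subtype.val).comp (star Q).mulVecLin).prod
      (((LinearMap.funLeft ℂ ℂ Subtype.val).comp (star P).mulVecLin).prod ℓ)
  have hF : LinearMap.ker F ≠ ⊥ := by
    apply LinearMap.ker_ne_bot_of_finrank_lt
    have := Fintype.card_subtype_compl (fun j => s < γ j)
    have := Fintype.card_subtype_le (fun j => s < γ j)
    simp only [Module.finrank_prod, Module.finrank_pi, Module.finrank_self]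
    omega
  obtain ⟨x, hx, hx0⟩ := Submodule.exists_mem_ne_zero_of_ne_bot hF
  have hx' : F x = 0 := hx
  have hy : ∀ j, s < β j → (star Q *ᵥ x) j = 0 := fun j hj =>
    congrFun (congrArg Prod.fst hx') ⟨j, hj⟩
  have hz : ∀ j, ¬ s < γ j → (star P *ᵥ x) j = 0 := fun j hj =>
    congrFun (congrArg (fun t => t.2.1) hx') ⟨j, hj⟩
  have hl : ℓ x = 0 := congrArg (fun t => t.2.2) hx'
  have key := hU.re_rayleigh s x
  rw [hℓ x hl, hV.re_rayleigh s x] at key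
  have hpos : 0 ≤ ∑ j, (Real.cos (β j - s / 2) - Real.cos (s / 2)) *
      normSq ((star Q *ᵥ x) j) := by
    refine Finset.sum_nonneg fun j _ => ?_
    by_cases hj : s < β j
    · simp [hy j hj]
    · refine mul_nonneg (sub_nonneg.2 ?_) (normSq_nonneg _)
      rw [← Real.cos_abs (β j - s / 2)]
      have := (hV.angle_mem j).1
      exact Real.cos_le_cos_of_nonneg_of_le_pi (abs_nonneg _) (by linarith)
        (abs_le.2 ⟨by linarith, by linarith⟩)
  have hcos : ∀ j, s < γ j → Real.cos (γ j - s / 2) < Real.cos (s / 2) := fun j hj => by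
    have h2 := (hU.angle_mem j).2
    rcases le_total (γ j - s / 2) Real.pi with h | h
    · exact Real.cos_lt_cos_of_nonneg_of_le_pi (by linarith) h (by linarith)
    · rw [← Real.cos_two_pi_sub (γ j - s / 2)]
      exact Real.cos_lt_cos_of_nonneg_of_le_pi (by linarith) (by linarith) (by linarith)
  have hne : star P *ᵥ x ≠ 0 := fun h0 => hx0 <| by
    rw [← one_mulVec x, ← Unitary.mul_star_self_of_mem hU.mem, ← mulVec_mulVec, h0, mulVec_zero]
  obtain ⟨k, hk⟩ := Function.ne_iff.1 hne
  have hneg : ∑ j, (Real.cos (γ j - s / 2) - Real.cos (s / 2)) *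
      normSq ((star P *ᵥ x) j) < 0 := by
    refine Finset.sum_neg' (fun j _ => ?_) ⟨k, Finset.mem_univ _, ?_⟩
    · by_cases hj : s < γ j
      · exact mul_nonpos_of_nonpos_of_nonneg (sub_nonpos.2 (hcos j hj).le) (normSq_nonneg _)
      · simp [hz j hj]
    · have hj : s < γ k := by
        by_contra hj
        exact hk (hz k hj)
      exact mul_neg_of_neg_of_pos (sub_neg.2 (hcos k hj)) (normSq_pos.2 hk)
  linarith

end IsAngleDiag

lemma sum_eq_integral_card {ι : Type*} [Fintype ι] {θ : ι → ℝ} {c : ℝ} (h : ∀ j, 0 ≤ θ j ∧ θ j ≤ c) :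
    IntervalIntegrable (fun s => (Fintype.card {j // s < θ j} : ℝ)) MeasureTheory.volume 0 c ∧
      ∫ s in (0 : ℝ)..c, (Fintype.card {j // s < θ j} : ℝ) = ∑ j, θ j := by
  have hcard : (fun s => (Fintype.card {j // s < θ j} : ℝ)) =
      fun s => ∑ j, (Set.Iio (θ j)).indicator (fun _ => (1 : ℝ)) s := by
    ext s
    simp [Fintype.card_subtype, Set.indicator_apply]
  have hint : ∀ j, IntervalIntegrable ((Set.Iio (θ j)).indicator (fun _ => (1 : ℝ)))
      MeasureTheory.volume 0 c := fun j =>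
    ⟨(intervalIntegrable_const (c := (1 : ℝ))).1.indicator measurableSet_Iio,
      (intervalIntegrable_const (c := (1 : ℝ))).2.indicator measurableSet_Iio⟩
  rw [hcard]
  refine ⟨?_, ?_⟩
  · have hsum := IntervalIntegrable.sum Finset.univ fun j _ => hint j
    rwa [Finset.sum_fn] at hsum
  rw [intervalIntegral.integral_finsetSum fun j _ => hint j]
  refine Finset.sum_congr rfl fun j _ => ?_
  rw [intervalIntegral.integral_of_le ((h j).1.trans (h j).2),
    MeasureTheory.setIntegral_indicator measurableSet_Iio]
  have hset : Set.Ioc 0 c ∩ Set.Iio (θ j) = Set.Ioo 0 (θ j) := by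
    ext x
    simp only [Set.mem_inter_iff, Set.mem_Ioc, Set.mem_Iio, Set.mem_Ioo]
    exact ⟨fun hx => ⟨hx.1.1, hx.2⟩, fun hx => ⟨⟨hx.1, hx.2.le.trans (h j).2⟩, hx.2⟩⟩
  rw [hset]
  simp [(h j).1]

lemma sum_le_sum_add_of_card_le {ι : Type*} [Fintype ι] {γ β : ι → ℝ} {c : ℝ}
    (hc : 0 ≤ c)
    (hγ : ∀ j, 0 ≤ γ j ∧ γ j ≤ c) (hβ : ∀ j, 0 ≤ β j ∧ β j ≤ c)
    (h : ∀ s, 0 ≤ s → s ≤ c → Fintype.card {j // s < γ j} ≤ Fintype.card {j // s < β j} + 1) :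
    ∑ j, γ j ≤ ∑ j, β j + c := by
  obtain ⟨h1, h2⟩ := sum_eq_integral_card hγ
  obtain ⟨h3, h4⟩ := sum_eq_integral_card hβ
  calc ∑ j, γ j = ∫ s in (0 : ℝ)..c, (Fintype.card {j // s < γ j} : ℝ) := h2.symm
    _ ≤ ∫ s in (0 : ℝ)..c, ((Fintype.card {j // s < β j} : ℝ) + 1) :=
      intervalIntegral.integral_mono_on hc h1 (h3.add intervalIntegrable_const) fun s hs => by
        exact_mod_cast h s hs.1 hs.2
    _ = _ := by
      rw [intervalIntegral.integral_add h3 intervalIntegrable_const, h4]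
      simp

lemma diagonal_mem_unitaryGroup {v : n → ℂ} (hv : ∀ j, ‖v j‖ = 1) :
    diagonal v ∈ unitaryGroup n ℂ := by
  rw [mem_unitaryGroup_iff, star_eq_conjTranspose, diagonal_conjTranspose, diagonal_mul_diagonal,
    ← diagonal_one]
  congr 1
  ext j
  simp [Complex.mul_conj, Complex.normSq_eq_norm_sq, hv]

/-- Left multiplication by a complex reflection with angle `α` increases the angle sum by at
most `α`. -/
lemma angleSum_reflection_mul_le {V : Matrix n n ℂ} (hV : V ∈ unitaryGroup n ℂ) (a : n) {α : ℝ}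
    (hα0 : 0 ≤ α) :
    angleSum (diagonal (Pi.mulSingle a (exp (I * α))) * V) ≤ α + angleSum V := by
  rcases hα0.eq_or_lt with rfl | hα
  · simp
  set D : Matrix n n ℂ := diagonal (Pi.mulSingle a (exp (I * α))) with hD
  have hDm : D ∈ unitaryGroup n ℂ := diagonal_mem_unitaryGroup fun j => by
    by_cases hj : j = a
    · subst hj; simp
    · simp [Pi.mulSingle_eq_of_ne hj]
  obtain ⟨P, γ, hU⟩ := exists_isAngleDiag (mul_mem hDm hV)
  obtain ⟨Q, β, hV'⟩ := exists_isAngleDiag hV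
  have hbound : angleSum (D * V) ≤ angleSum V + 2 * Real.pi := by
    rw [hU.angleSum_eq, hV'.angleSum_eq]
    refine sum_le_sum_add_of_card_le Real.two_pi_pos.le
      (fun j => ⟨(hU.angle_mem j).1, (hU.angle_mem j).2.le⟩)
      (fun j => ⟨(hV'.angle_mem j).1, (hV'.angle_mem j).2.le⟩) fun s hs0 hs =>
      hU.card_le_card_add_one hV' ((LinearMap.proj a).comp V.mulVecLin) (fun x hx => ?_) hs0 hs
    rw [← mulVec_mulVec]
    ext j
    rw [hD, mulVec_diagonal]
    by_cases hj : j = a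
    · subst hj
      have : (V *ᵥ x) j = 0 := hx
      rw [this, mul_zero]
    · rw [Pi.mulSingle_eq_of_ne hj, one_mul]
  have hdet : exp (I * angleSum (D * V)) = exp (I * (α + angleSum V)) := by
    rw [hU.exp_angleSum, det_mul, ← hV'.exp_angleSum, mul_add, Complex.exp_add, hD, det_diagonal]
    simp
  obtain ⟨m, hm⟩ := Complex.exp_eq_exp_iff_exists_int.1 hdet
  have hm' : angleSum (D * V) = α + angleSum V + m * (2 * Real.pi) := by
    have : I * (angleSum (D * V) : ℂ) = I * ((α + angleSum V + m * (2 * Real.pi) : ℝ) : ℂ) := by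
      rw [hm]; push_cast; ring
    exact_mod_cast mul_left_cancel₀ I_ne_zero this
  have hm1 : m < 1 := by
    by_contra! h
    have : (1 : ℝ) ≤ m := by exact_mod_cast h
    nlinarith [Real.pi_pos]
  have : (m : ℝ) ≤ 0 := by exact_mod_cast Int.lt_add_one_iff.1 hm1
  nlinarith [Real.pi_pos]

lemma angleSum_diagonal_mul_le {V : Matrix n n ℂ} (hV : V ∈ unitaryGroup n ℂ) {α : n → ℝ}
    (hα : ∀ j, 0 ≤ α j) (s : Finset n) :
    angleSum (diagonal (fun j => if j ∈ s then exp (I * α j) else 1) * V) ≤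
      ∑ j ∈ s, α j + angleSum V := by
  induction s using Finset.induction_on with
  | empty => simp
  | insert a s ha ih =>
    have hsplit : diagonal (fun j => if j ∈ insert a s then exp (I * α j) else 1) =
        diagonal (Pi.mulSingle a (exp (I * α a))) *
          diagonal (fun j => if j ∈ s then exp (I * α j) else 1) := by
      rw [diagonal_mul_diagonal]
      congr 1
      ext j
      by_cases hj : j = a
      · subst hj; simp [ha]
      · simp [hj]
    have hmem : diagonal (fun j => if j ∈ s then exp (I * α j) else 1) ∈ unitaryGroup n ℂ :=
      diagonal_mem_unitaryGroup fun j => by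
        split_ifs
        · exact Complex.norm_exp_I_mul_ofReal _
        · simp
    rw [hsplit, mul_assoc, Finset.sum_insert ha]
    linarith [angleSum_reflection_mul_le (mul_mem hmem hV) a (hα a)]

/-- The sum of the arguments in `[0, 2π)` of the eigenvalues is subadditive on the unitary
group. -/
theorem angleSum_mul_le {U V : Matrix n n ℂ} (hU : U ∈ unitaryGroup n ℂ)
    (hV : V ∈ unitaryGroup n ℂ) : angleSum (U * V) ≤ angleSum U + angleSum V := by
  obtain ⟨P, θ, h⟩ := exists_isAngleDiag hU
  have hP' : star P ∈ unitaryGroup n ℂ := Unitary.star_mem h.mem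
  have h1 : angleSum (U * V) =
      angleSum (diagonal (fun j => exp (I * θ j)) * (star P * V * P)) := by
    rw [← angleSum_unitary_conj h.mem (diagonal _ * _), h.eq]
    congr 1
    simp only [mul_assoc, Unitary.mul_star_self_of_mem h.mem, mul_one]
  have h2 : angleSum V = angleSum (star P * V * P) := by
    rw [← angleSum_unitary_conj hP' V, star_star]
  have := angleSum_diagonal_mul_le (mul_mem (mul_mem hP' hV) h.mem)
    (fun j => (h.angle_mem j).1) Finset.univ
  rw [h1, h2, h.angleSum_eq]
  simpa using this

lemma angleSum_star {M : Matrix n n ℂ} {θ : n → ℝ} (h : ∀ j, 0 ≤ θ j ∧ θ j < 2 * Real.pi)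
    (hM : M.charpoly = ∏ j, (Polynomial.X - Polynomial.C (exp (I * (θ j : ℂ))))) :
    angleSum (star M) = ∑ j, if θ j = 0 then 0 else 2 * Real.pi - θ j := by
  refine angleSum_eq (fun j => ?_) ?_
  · split_ifs with h0
    · exact ⟨le_rfl, Real.two_pi_pos⟩
    · have := (h j).1.lt_of_ne' h0
      exact ⟨by linarith [(h j).2], by linarith⟩
  · have h1 : (star M).charpoly = M.charpoly.map (starRingEnd ℂ) := by
      rw [← charpoly_map, ← charpoly_transpose]
      rfl
    rw [h1, hM, Polynomial.map_prod]
    refine Finset.prod_congr rfl fun j _ => ?_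
    rw [Polynomial.map_sub, Polynomial.map_X, Polynomial.map_C, ← Complex.exp_conj]
    congr 2
    split_ifs with h0
    · simp [h0]
    · rw [Complex.exp_eq_exp_iff_exists_int]
      refine ⟨-1, ?_⟩
      simp
      ring

lemma rho_eq {ι : Type*} [Fintype ι] (θ : ι → ℝ) :
    (∑ j, if θ j = 0 then (0 : ℝ) else 1 - θ j / Real.pi) =
      ((∑ j, if θ j = 0 then 0 else 2 * Real.pi - θ j) - ∑ j, θ j) / (2 * Real.pi) := by
  rw [← Finset.sum_sub_distrib, Finset.sum_div]
  refine Finset.sum_congr rfl fun j _ => ?_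
  split_ifs with h0
  · simp [h0]
  · field_simp
    ring

end

end RhoInvariant

open RhoInvariant in
/-- Milnor–Wood type inequality for the rho invariant on `U(p)`: if `A·B·C = 1` in
`U(p)` and the eigenvalues of `A, B, C` are `e^{iθ}` with `θ ∈ [0, 2π)`, then
`|ρ(A) + ρ(B) + ρ(C)| ≤ p` where `ρ = Σ_{θ_j ≠ 0} (1 − θ_j/π)`. -/
theorem stmt17 (p : ℕ) (A B C : Matrix (Fin p) (Fin p) ℂ)
    (hA : A ∈ Matrix.unitaryGroup (Fin p) ℂ)
    (hB : B ∈ Matrix.unitaryGroup (Fin p) ℂ)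
    (hC : C ∈ Matrix.unitaryGroup (Fin p) ℂ)
    (hABC : A * B * C = 1)
    (θA θB θC : Fin p → ℝ)
    (hθA : ∀ j, 0 ≤ θA j ∧ θA j < 2 * Real.pi)
    (hθB : ∀ j, 0 ≤ θB j ∧ θB j < 2 * Real.pi)
    (hθC : ∀ j, 0 ≤ θC j ∧ θC j < 2 * Real.pi)
    (hAspec : A.charpoly = ∏ j, (Polynomial.X -
      Polynomial.C (Complex.exp (Complex.I * (θA j : ℂ)))))
    (hBspec : B.charpoly = ∏ j, (Polynomial.X -
      Polynomial.C (Complex.exp (Complex.I * (θB j : ℂ)))))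
    (hCspec : C.charpoly = ∏ j, (Polynomial.X -
      Polynomial.C (Complex.exp (Complex.I * (θC j : ℂ))))) :
    |(∑ j, if θA j = 0 then (0 : ℝ) else 1 - θA j / Real.pi) +
      (∑ j, if θB j = 0 then (0 : ℝ) else 1 - θB j / Real.pi) +
      (∑ j, if θC j = 0 then (0 : ℝ) else 1 - θC j / Real.pi)| ≤ p := by
  have hBCA : B * C * A = 1 := by
    rw [mul_assoc] at hABC
    exact mul_eq_one_comm.1 hABC
  have hCAB : C * A * B = 1 := by
    rw [mul_assoc]
    exact mul_eq_one_comm.1 hABC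
  have aux : ∀ X Y Z : Matrix (Fin p) (Fin p) ℂ, X ∈ Matrix.unitaryGroup (Fin p) ℂ →
      Y ∈ Matrix.unitaryGroup (Fin p) ℂ → Z ∈ Matrix.unitaryGroup (Fin p) ℂ → X * Y * Z = 1 →
      angleSum (star Z) ≤ angleSum X + angleSum Y ∧
        angleSum Z ≤ angleSum (star X) + angleSum (star Y) := by
    intro X Y Z hX hY hZ h
    have h1 : X * Y = star Z := by
      rw [← mul_one (X * Y), ← Unitary.mul_star_self_of_mem hZ, ← mul_assoc, h, one_mul]
    have h2 : star Y * star X = Z := by rw [← star_mul, h1, star_star]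
    refine ⟨h1 ▸ angleSum_mul_le hX hY, ?_⟩
    have := angleSum_mul_le (Unitary.star_mem hY) (Unitary.star_mem hX)
    rw [h2] at this
    linarith
  obtain ⟨h1, h1'⟩ := aux A B C hA hB hC hABC
  obtain ⟨h2, h2'⟩ := aux B C A hB hC hA hBCA
  have hpi := Real.two_pi_pos
  have hb : angleSum B + angleSum (star B) ≤ 2 * Real.pi * p := by
    rw [angleSum_eq hθB hBspec, angleSum_star hθB hBspec, ← Finset.sum_add_distrib]
    refine (Finset.sum_le_card_nsmul _ _ (2 * Real.pi) fun j _ => ?_).trans_eq ?_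
    · split_ifs with h0
      · rw [h0]; linarith
      · linarith
    · simp [mul_comm]
  rw [rho_eq, rho_eq, rho_eq, ← angleSum_star hθA hAspec, ← angleSum_star hθB hBspec,
    ← angleSum_star hθC hCspec, ← angleSum_eq hθA hAspec, ← angleSum_eq hθB hBspec,
    ← angleSum_eq hθC hCspec, ← add_div, ← add_div, abs_div, abs_of_pos hpi, div_le_iff₀ hpi,
    abs_le]
  constructor <;> linarith
end
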